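/- Let N, D be positive integers, M ≥ 0, and A ∈ ℝ^{D×D}. Define f̃(X) = softmax(X A^⊤ X^⊤) · X for X ∈ ℝ^{N×D}, with softmax applied row-wise. Then f̃ is Lipschitz on the set {X ∈ ℝ^{N×D} : ‖X‖_F ≤ M} with respect to the Frobenius norm, with Lipschitz constant at most ‖A‖_2 · M² · (√N + 1) + √N. -/

import Mathlib

open scoped Matrix

/-- Frobenius norm of a real matrix. -/
noncomputable def frobNorm {m n : Type*} [Fintype m] [Fintype n] (X : Matrix m n ℝ) : ℝ :=
  Real.sqrt (∑ i, ∑ j, (X i j) ^ 2)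

/-- Spectral norm (operator norm induced by Euclidean norms) of a real matrix. -/
noncomputable def specNorm {m n : ℕ} (A : Matrix (Fin m) (Fin n) ℝ) : ℝ :=
  ‖(Matrix.toEuclideanLin A).toContinuousLinearMap‖

/-- Euclidean norm of a vector in ℝ^n. -/
noncomputable def evNorm {n : ℕ} (v : Fin n → ℝ) : ℝ := Real.sqrt (∑ i, (v i) ^ 2)

/-- Row-wise softmax of a square matrix. -/
noncomputable def softmax {N : ℕ} (M : Matrix (Fin N) (Fin N) ℝ) : Matrix (Fin N) (Fin N) ℝ :=
  Matrix.of fun i j => Real.exp (M i j) / ∑ k, Real.exp (M i k)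

/-- Horizontal concatenation `[f 0, f 1, …, f (R-1)]` of `R` matrices of size `m × n`
into a single `m × (R·n)` matrix (block `r` occupies columns `r·n, …, r·n + n - 1`). -/
def hConcat {m n R : ℕ} (f : Fin R → Matrix (Fin m) (Fin n) ℝ) :
    Matrix (Fin m) (Fin (R * n)) ℝ :=
  Matrix.of fun i j => f j.divNat i j.modNat

/-- Vertical stacking of `R` matrices of size `m × n` into a single `(R·m) × n` matrix
(block `r` occupies rows `r·m, …, r·m + m - 1`). -/
def vConcat {m n R : ℕ} (f : Fin R → Matrix (Fin m) (Fin n) ℝ) :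
    Matrix (Fin (R * m)) (Fin n) ℝ :=
  Matrix.of fun i j => f i.divNat i.modNat j

section FrobeniusNorm

attribute [local instance] Matrix.frobeniusNormedAddCommGroup

variable {l m n : Type*} [Fintype l] [Fintype m] [Fintype n]

lemma frobNorm_eq_norm (X : Matrix m n ℝ) : frobNorm X = ‖X‖ := by
  rw [Matrix.frobenius_norm_def, frobNorm, Real.sqrt_eq_rpow]
  simp

lemma frobNorm_nonneg (X : Matrix m n ℝ) : 0 ≤ frobNorm X := Real.sqrt_nonneg _

lemma frobNorm_sq (X : Matrix m n ℝ) : frobNorm X ^ 2 = ∑ i, ∑ j, X i j ^ 2 :=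
  Real.sq_sqrt (Finset.sum_nonneg fun _ _ => Finset.sum_nonneg fun _ _ => sq_nonneg _)

lemma frobNorm_add_le (X Y : Matrix m n ℝ) : frobNorm (X + Y) ≤ frobNorm X + frobNorm Y := by
  simpa only [frobNorm_eq_norm] using norm_add_le X Y

lemma frobNorm_mul_le (X : Matrix l m ℝ) (Y : Matrix m n ℝ) :
    frobNorm (X * Y) ≤ frobNorm X * frobNorm Y := by
  simpa only [frobNorm_eq_norm] using Matrix.frobenius_norm_mul X Y

lemma frobNorm_transpose (X : Matrix m n ℝ) : frobNorm Xᵀ = frobNorm X := by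
  simpa only [frobNorm_eq_norm] using Matrix.frobenius_norm_transpose X

end FrobeniusNorm

lemma specNorm_nonneg {m n : ℕ} (A : Matrix (Fin m) (Fin n) ℝ) : 0 ≤ specNorm A := norm_nonneg _

lemma sum_sq_mulVec_le {m n : ℕ} (A : Matrix (Fin m) (Fin n) ℝ) (v : Fin n → ℝ) :
    ∑ i, (A *ᵥ v) i ^ 2 ≤ specNorm A ^ 2 * ∑ j, v j ^ 2 := by
  have h := (Matrix.toEuclideanLin A).toContinuousLinearMap.le_opNorm (WithLp.toLp 2 v)
  have h2 := pow_le_pow_left₀ (norm_nonneg _) h 2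
  rw [mul_pow, EuclideanSpace.norm_sq_eq, EuclideanSpace.norm_sq_eq] at h2
  simpa [specNorm, Matrix.toLpLin_toLp] using h2

lemma frobNorm_mul_transpose_le {l m n : ℕ} (X : Matrix (Fin l) (Fin n) ℝ)
    (A : Matrix (Fin m) (Fin n) ℝ) : frobNorm (X * Aᵀ) ≤ frobNorm X * specNorm A := by
  refine le_of_sq_le_sq ?_ (mul_nonneg (frobNorm_nonneg X) (specNorm_nonneg A))
  rw [mul_pow, frobNorm_sq, frobNorm_sq, Finset.sum_mul]
  refine Finset.sum_le_sum fun i _ => ?_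
  have hrow : ∀ j, (X * Aᵀ) i j = (A *ᵥ X i) j := fun j => by
    simp [Matrix.mul_apply, Matrix.mulVec, dotProduct, mul_comm]
  simp only [hrow]
  rw [mul_comm]
  exact sum_sq_mulVec_le A (X i)

/-- The covariance of `g` and `d` under a probability vector `p` is at most `‖g‖ ‖d‖`. -/
lemma covariance_sq_le {ι : Type*} [Fintype ι] (p g d : ι → ℝ) (hp : ∀ i, 0 ≤ p i)
    (hsum : ∑ i, p i = 1) :
    (∑ i, p i * g i * d i - (∑ i, p i * g i) * ∑ i, p i * d i) ^ 2 ≤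
      (∑ i, g i ^ 2) * ∑ i, d i ^ 2 := by
  have hp1 : ∀ i, p i ≤ 1 := fun i =>
    hsum ▸ Finset.single_le_sum (fun j _ => hp j) (Finset.mem_univ i)
  set m := ∑ i, p i * d i with hm
  have hcov : ∑ i, p i * g i * d i - (∑ i, p i * g i) * m = ∑ i, g i * (p i * (d i - m)) := by
    rw [Finset.sum_mul, ← Finset.sum_sub_distrib]
    exact Finset.sum_congr rfl fun i _ => by ring
  have hvar : ∑ i, p i * (d i - m) ^ 2 = ∑ i, p i * d i ^ 2 - m ^ 2 := by
    calc ∑ i, p i * (d i - m) ^ 2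
        = ∑ i, (p i * d i ^ 2 - 2 * m * (p i * d i) + m ^ 2 * p i) :=
          Finset.sum_congr rfl fun i _ => by ring
      _ = ∑ i, p i * d i ^ 2 - m ^ 2 := by
          rw [Finset.sum_add_distrib, Finset.sum_sub_distrib, ← Finset.mul_sum, ← Finset.mul_sum,
            hsum, ← hm]
          ring
  rw [hcov]
  refine (Finset.sum_mul_sq_le_sq_mul_sq _ _ _).trans ?_
  refine mul_le_mul_of_nonneg_left ?_ (Finset.sum_nonneg fun _ _ => sq_nonneg _)
  calc ∑ i, (p i * (d i - m)) ^ 2 ≤ ∑ i, p i * (d i - m) ^ 2 := by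
        refine Finset.sum_le_sum fun i _ => ?_
        rw [mul_pow]
        exact mul_le_mul_of_nonneg_right (by nlinarith [hp i, hp1 i]) (sq_nonneg _)
    _ ≤ ∑ i, p i * d i ^ 2 := by rw [hvar]; linarith [sq_nonneg m]
    _ ≤ ∑ i, d i ^ 2 :=
        Finset.sum_le_sum fun i _ => mul_le_of_le_one_left (sq_nonneg _) (hp1 i)

/-- The softmax of a vector is `1`-Lipschitz for the Euclidean norm. -/
lemma sum_sq_softmax_sub_le {ι : Type*} [Fintype ι] [Nonempty ι] (a b : ι → ℝ) :
    ∑ i, (Real.exp (a i) / ∑ k, Real.exp (a k) - Real.exp (b i) / ∑ k, Real.exp (b k)) ^ 2 ≤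
      ∑ i, (a i - b i) ^ 2 := by
  set g : ι → ℝ := fun i =>
    Real.exp (a i) / ∑ k, Real.exp (a k) - Real.exp (b i) / ∑ k, Real.exp (b k) with hg
  set d : ι → ℝ := fun i => a i - b i with hd
  let e : ℝ → ι → ℝ := fun t i => Real.exp (b i + t * d i)
  have hpos : ∀ t, 0 < ∑ k, e t k := fun t =>
    Finset.sum_pos (fun _ _ => Real.exp_pos _) Finset.univ_nonempty
  have hde : ∀ t i, HasDerivAt (fun s => e s i) (e t i * d i) t := fun t i => by
    simpa using (((hasDerivAt_id t).mul_const (d i)).const_add (b i)).exp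
  have hderiv : ∀ t, HasDerivAt (fun s => (∑ i, g i * e s i) / ∑ k, e s k)
      (((∑ i, g i * (e t i * d i)) * (∑ k, e t k) - (∑ i, g i * e t i) * ∑ k, e t k * d k) /
        (∑ k, e t k) ^ 2) t := fun t =>
    (HasDerivAt.fun_sum fun i _ => (hde t i).const_mul (g i)).fun_div
      (HasDerivAt.fun_sum fun i _ => hde t i) (hpos t).ne'
  obtain ⟨t, -, ht⟩ := exists_hasDerivAt_eq_slope _ _ zero_lt_one
    (fun t _ => (hderiv t).continuousAt.continuousWithinAt) (fun t _ => hderiv t)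
  have hslope : (∑ i, g i * e 1 i) / ∑ k, e 1 k - (∑ i, g i * e 0 i) / ∑ k, e 0 k
      = ∑ i, g i ^ 2 := by
    rw [Finset.sum_div, Finset.sum_div, ← Finset.sum_sub_distrib]
    refine Finset.sum_congr rfl fun i _ => ?_
    simp only [e, hd, zero_mul, add_zero, one_mul, add_sub_cancel]
    rw [mul_div_assoc, mul_div_assoc, ← mul_sub, sq]
  rw [sub_zero, div_one, hslope] at ht
  have hcov := covariance_sq_le (fun i => e t i / ∑ k, e t k) g d
    (fun i => div_nonneg (Real.exp_pos _).le (hpos t).le)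
    (by rw [← Finset.sum_div, div_self (hpos t).ne'])
  have heq : ∑ i, e t i / (∑ k, e t k) * g i * d i -
      (∑ i, e t i / (∑ k, e t k) * g i) * ∑ i, e t i / (∑ k, e t k) * d i = ∑ i, g i ^ 2 := by
    rw [← ht]
    simp only [div_mul_eq_mul_div, ← Finset.sum_div]
    have hne := (hpos t).ne'
    have h1 : ∑ i, e t i * g i * d i = ∑ i, g i * (e t i * d i) :=
      Finset.sum_congr rfl fun i _ => by ring
    have h2 : ∑ i, e t i * g i = ∑ i, g i * e t i :=
      Finset.sum_congr rfl fun i _ => by ring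
    rw [h1, h2]
    field_simp
  rw [heq, sq] at hcov
  rcases (Finset.sum_nonneg fun i _ => sq_nonneg (g i) : 0 ≤ ∑ i, g i ^ 2).eq_or_lt with h0 | h0
  · rw [← h0]
    exact Finset.sum_nonneg fun i _ => sq_nonneg _
  · exact le_of_mul_le_mul_left hcov h0

lemma frobNorm_softmax_sub_le {N : ℕ} (S T : Matrix (Fin N) (Fin N) ℝ) :
    frobNorm (softmax S - softmax T) ≤ frobNorm (S - T) := by
  refine Real.sqrt_le_sqrt (Finset.sum_le_sum fun i _ => ?_)
  have : Nonempty (Fin N) := ⟨i⟩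
  exact sum_sq_softmax_sub_le (S i) (T i)

lemma frobNorm_softmax_le {N : ℕ} (S : Matrix (Fin N) (Fin N) ℝ) :
    frobNorm (softmax S) ≤ Real.sqrt N := by
  refine Real.sqrt_le_sqrt ?_
  calc ∑ i, ∑ j, softmax S i j ^ 2 ≤ ∑ _i : Fin N, (1 : ℝ) := by
        refine Finset.sum_le_sum fun i _ => ?_
        have hpos : 0 < ∑ k, Real.exp (S i k) :=
          Finset.sum_pos (fun _ _ => Real.exp_pos _) ⟨i, Finset.mem_univ i⟩
        have hsum : ∑ j, softmax S i j = 1 := by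
          simp only [softmax, Matrix.of_apply]
          rw [← Finset.sum_div, div_self hpos.ne']
        have hnn : ∀ j, 0 ≤ softmax S i j := fun j => div_nonneg (Real.exp_pos _).le hpos.le
        calc ∑ j, softmax S i j ^ 2 ≤ (∑ j, softmax S i j) ^ 2 :=
              Finset.sum_sq_le_sq_sum_of_nonneg fun j _ => hnn j
          _ = 1 := by rw [hsum, one_pow]
    _ = N := by simp

lemma frobNorm_bilinear_sub_le {N D : ℕ} {M : ℝ} (A : Matrix (Fin D) (Fin D) ℝ)
    {X Y : Matrix (Fin N) (Fin D) ℝ} (hX : frobNorm X ≤ M) (hY : frobNorm Y ≤ M) :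
    frobNorm (X * Aᵀ * Xᵀ - Y * Aᵀ * Yᵀ) ≤ 2 * (specNorm A * M * frobNorm (X - Y)) := by
  have hA := specNorm_nonneg A
  have hd := frobNorm_nonneg (X - Y)
  have hsplit : X * Aᵀ * Xᵀ - Y * Aᵀ * Yᵀ = (X - Y) * Aᵀ * Xᵀ + Y * Aᵀ * (X - Y)ᵀ := by
    simp only [Matrix.transpose_sub, Matrix.sub_mul, Matrix.mul_sub]
    abel
  have h1 : frobNorm ((X - Y) * Aᵀ * Xᵀ) ≤ frobNorm (X - Y) * specNorm A * M := by
    refine (frobNorm_mul_le _ _).trans ?_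
    rw [frobNorm_transpose]
    exact mul_le_mul (frobNorm_mul_transpose_le _ _) hX (frobNorm_nonneg _) (mul_nonneg hd hA)
  have h2 : frobNorm (Y * Aᵀ * (X - Y)ᵀ) ≤ M * specNorm A * frobNorm (X - Y) := by
    refine (frobNorm_mul_le _ _).trans ?_
    rw [frobNorm_transpose]
    exact mul_le_mul_of_nonneg_right ((frobNorm_mul_transpose_le _ _).trans
      (mul_le_mul_of_nonneg_right hY hA)) hd
  rw [hsplit]
  refine (frobNorm_add_le _ _).trans ((add_le_add h1 h2).trans_eq ?_)
  ring

/-- The map `X ↦ softmax(X Aᵀ Xᵀ) X` is Lipschitz on the Frobenius ball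
of radius `M`, with Lipschitz constant at most `‖A‖₂ · M² · (√N + 1) + √N`. -/
theorem softmax_attention_core_locally_lipschitz
    (N D : ℕ) (hN : 0 < N) (hD : 0 < D)
    (M : ℝ) (hM : 0 ≤ M) (A : Matrix (Fin D) (Fin D) ℝ)
    (ftilde : Matrix (Fin N) (Fin D) ℝ → Matrix (Fin N) (Fin D) ℝ)
    (hft : ∀ X, ftilde X = softmax (X * Aᵀ * Xᵀ) * X) :
    ∀ X Y : Matrix (Fin N) (Fin D) ℝ, frobNorm X ≤ M → frobNorm Y ≤ M →
      frobNorm (ftilde X - ftilde Y) ≤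
        (specNorm A * M ^ 2 * (Real.sqrt N + 1) + Real.sqrt N) * frobNorm (X - Y) := by
  intro X Y hX hY
  have hA := specNorm_nonneg A
  have hd := frobNorm_nonneg (X - Y)
  have hN1 : 1 ≤ Real.sqrt N := Real.one_le_sqrt.mpr (by exact_mod_cast hN)
  have hsplit : ftilde X - ftilde Y = softmax (X * Aᵀ * Xᵀ) * (X - Y) +
      (softmax (X * Aᵀ * Xᵀ) - softmax (Y * Aᵀ * Yᵀ)) * Y := by
    rw [hft, hft, Matrix.sub_mul, Matrix.mul_sub]
    abel
  have h1 : frobNorm (softmax (X * Aᵀ * Xᵀ) * (X - Y)) ≤ Real.sqrt N * frobNorm (X - Y) :=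
    (frobNorm_mul_le _ _).trans (mul_le_mul_of_nonneg_right (frobNorm_softmax_le _) hd)
  have h2 : frobNorm ((softmax (X * Aᵀ * Xᵀ) - softmax (Y * Aᵀ * Yᵀ)) * Y) ≤
      2 * (specNorm A * M * frobNorm (X - Y)) * M :=
    (frobNorm_mul_le _ _).trans (mul_le_mul
      ((frobNorm_softmax_sub_le _ _).trans (frobNorm_bilinear_sub_le A hX hY)) hY
      (frobNorm_nonneg _) (by positivity))
  have h3 : 0 ≤ specNorm A * M ^ 2 * frobNorm (X - Y) := by positivity
  rw [hsplit]
  refine (frobNorm_add_le _ _).trans ((add_le_add h1 h2).trans ?_)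
  nlinarith [mul_nonneg h3 (sub_nonneg.mpr hN1)]
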